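/- arXiv:2112.01212 — 3 statements merged into one kernel-verified Lean document; each statement's English description precedes it below -/
import Mathlib

section
/- Let V be a real inner product space of dimension n ≥ 4 and let R be an algebraic curvature tensor on V whose curvature operator of the second kind R̂ is two-non-negative. Then R satisfies the NIC1 condition: for every orthonormal 4-tuple (e₁,e₂,e₃,e₄) in V and every λ ∈ [0,1], R_{1313} + λ²R_{1414} + R_{2323} + λ²R_{2424} − 2λR_{1234} ≥ 0. -/
open scoped BigOperators

noncomputable section

/-- The curvature operator of the second kind `R̂`, as a bilinear form on
(trace-free) symmetric two-tensors, expressed in components with respect to an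
orthonormal basis `b`:  `R̂(s,t) = ∑_{i,j,k,l} R_{iklj} s_{kl} t_{ij}`. -/
def secondKind {V : Type*} [NormedAddCommGroup V] [InnerProductSpace ℝ V] {n : ℕ}
    (R : V →ₗ[ℝ] V →ₗ[ℝ] V →ₗ[ℝ] V →ₗ[ℝ] ℝ)
    (b : OrthonormalBasis (Fin n) ℝ V)
    (s t : Matrix (Fin n) (Fin n) ℝ) : ℝ :=
  ∑ i, ∑ j, ∑ k, ∑ l, R (b i) (b k) (b l) (b j) * s k l * t i j

/-- `R` is an algebraic curvature tensor: it has the symmetries of a Riemannian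
curvature tensor and satisfies the first Bianchi identity. -/
def IsAlgCurv {V : Type*} [NormedAddCommGroup V] [InnerProductSpace ℝ V]
    (R : V →ₗ[ℝ] V →ₗ[ℝ] V →ₗ[ℝ] V →ₗ[ℝ] ℝ) : Prop :=
  (∀ x y z w, R x y z w = - R y x z w) ∧
  (∀ x y z w, R x y z w = - R x y w z) ∧
  (∀ x y z w, R x y z w = R z w x y) ∧
  (∀ x y z w, R x y z w + R x z w y + R x w y z = 0)


/-- `R̂` is `k`-non-negative: for every orthonormal basis and every `k` pairwise
orthogonal unit-norm trace-free symmetric two-tensors `h_1, …, h_k` (given by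
their component matrices), `∑ₐ R̂(hₐ,hₐ) ≥ 0`. -/
def kNonNegSecondKind {V : Type*} [NormedAddCommGroup V] [InnerProductSpace ℝ V]
    (n k : ℕ) (R : V →ₗ[ℝ] V →ₗ[ℝ] V →ₗ[ℝ] V →ₗ[ℝ] ℝ) : Prop :=
  ∀ (b : OrthonormalBasis (Fin n) ℝ V) (h : Fin k → Matrix (Fin n) (Fin n) ℝ),
    (∀ a, (h a).IsSymm) →
    (∀ a, (h a).trace = 0) →
    (∀ a, ∑ i, ∑ j, h a i j * h a i j = 1) →
    (∀ a a', a ≠ a' → ∑ i, ∑ j, h a i j * h a' i j = 0) →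
    0 ≤ ∑ a, secondKind R b (h a) (h a)

/-- The symmetric matrix `a (E_pq + E_qp) + c (E_rs + E_sr)`. -/
def symmPair {n : ℕ} (p q r s : Fin n) (a c : ℝ) : Matrix (Fin n) (Fin n) ℝ :=
  Matrix.single p q a + Matrix.single q p a + (Matrix.single r s c + Matrix.single s r c)

theorem symmPair_isSymm {n : ℕ} (p q r s : Fin n) (a c : ℝ) :
    (symmPair p q r s a c).IsSymm := by
  simp only [Matrix.IsSymm, symmPair, Matrix.transpose_add, Matrix.transpose_single]
  abel

theorem trace_symmPair {n : ℕ} {p q r s : Fin n} (hpq : p ≠ q) (hrs : r ≠ s) (a c : ℝ) :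
    (symmPair p q r s a c).trace = 0 := by
  simp [symmPair, Matrix.trace_add, Matrix.trace_single_eq_of_ne, hpq, hrs, hpq.symm, hrs.symm]

theorem sum_single_mul {n : ℕ} (p q : Fin n) (a : ℝ) (N : Fin n → Fin n → ℝ) :
    ∑ i, ∑ j, Matrix.single p q a i j * N i j = a * N p q := by
  simp [Matrix.single_apply, ite_and]

theorem sum_symmPair_mul {n : ℕ} (p q r s : Fin n) (a c : ℝ) (N : Fin n → Fin n → ℝ) :
    ∑ i, ∑ j, symmPair p q r s a c i j * N i j
      = a * (N p q + N q p) + c * (N r s + N s r) := by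
  simp only [symmPair, Matrix.add_apply, add_mul, Finset.sum_add_distrib, sum_single_mul]
  ring

theorem sum_symmPair_mul_symmPair {n : ℕ} (p q r s p' q' r' s' : Fin n) (a c a' c' : ℝ) :
    ∑ i, ∑ j, symmPair p q r s a c i j * symmPair p' q' r' s' a' c' i j
      = a * (symmPair p' q' r' s' a' c' p q + symmPair p' q' r' s' a' c' q p)
        + c * (symmPair p' q' r' s' a' c' r s + symmPair p' q' r' s' a' c' s r) :=
  sum_symmPair_mul p q r s a c _

theorem secondKind_symmPair {V : Type*} [NormedAddCommGroup V] [InnerProductSpace ℝ V] {n : ℕ}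
    {R : V →ₗ[ℝ] V →ₗ[ℝ] V →ₗ[ℝ] V →ₗ[ℝ] ℝ} (hR : IsAlgCurv R)
    (b : OrthonormalBasis (Fin n) ℝ V) (p q r s : Fin n) (a c : ℝ) :
    secondKind R b (symmPair p q r s a c) (symmPair p q r s a c)
      = 2 * (a ^ 2 * R (b p) (b q) (b p) (b q) + c ^ 2 * R (b r) (b s) (b r) (b s)
        + 2 * (a * c) * (R (b r) (b p) (b q) (b s) + R (b r) (b q) (b p) (b s))) := by
  obtain ⟨h1, h2, h3, -⟩ := hR
  have h0 (x z w : V) : R x x z w = 0 := by linarith [h1 x x z w]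
  have hflip (x y z w : V) : R x y z w = R y x w z := by rw [h1, h2, neg_neg]
  have key : secondKind R b (symmPair p q r s a c) (symmPair p q r s a c)
      = ∑ i, ∑ j, symmPair p q r s a c i j *
          ∑ k, ∑ l, symmPair p q r s a c k l * R (b i) (b k) (b l) (b j) := by
    simp only [secondKind, Finset.mul_sum]
    refine Finset.sum_congr rfl fun i _ => Finset.sum_congr rfl fun j _ =>
      Finset.sum_congr rfl fun k _ => Finset.sum_congr rfl fun l _ => by ring
  rw [key, sum_symmPair_mul]
  simp only [sum_symmPair_mul, h0]
  linear_combination a * c * (hflip (b p) (b r) (b s) (b q) + hflip (b q) (b r) (b s) (b p)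
      + hflip (b s) (b p) (b q) (b r) + hflip (b s) (b q) (b p) (b r)
      + 2 * h3 (b p) (b s) (b r) (b q) + 2 * h3 (b q) (b s) (b r) (b p))
    + a ^ 2 * hflip (b q) (b p) (b q) (b p) + c ^ 2 * hflip (b s) (b r) (b s) (b r)

theorem kNonNegSecondKind.four_frame {V : Type*} [NormedAddCommGroup V] [InnerProductSpace ℝ V]
    {n : ℕ} {R : V →ₗ[ℝ] V →ₗ[ℝ] V →ₗ[ℝ] V →ₗ[ℝ] ℝ} (hnn : kNonNegSecondKind n 2 R)
    (hR : IsAlgCurv R) (b : OrthonormalBasis (Fin n) ℝ V) {p q r s : Fin n}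
    (hpq : p ≠ q) (hpr : p ≠ r) (hps : p ≠ s) (hqr : q ≠ r) (hqs : q ≠ s) (hrs : r ≠ s)
    (lam : ℝ) :
    0 ≤ R (b p) (b r) (b p) (b r) + lam ^ 2 * R (b p) (b s) (b p) (b s)
      + R (b q) (b r) (b q) (b r) + lam ^ 2 * R (b q) (b s) (b q) (b s)
      - 6 * lam * R (b p) (b q) (b r) (b s) := by
  have hpos : 0 < 2 * (1 + lam ^ 2) := by positivity
  obtain ⟨t, ht⟩ : ∃ t : ℝ, t ^ 2 = (2 * (1 + lam ^ 2))⁻¹ :=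
    ⟨√(2 * (1 + lam ^ 2))⁻¹, Real.sq_sqrt (by positivity)⟩
  have ht1 : t ^ 2 * (2 * (1 + lam ^ 2)) = 1 := by rw [ht]; exact inv_mul_cancel₀ hpos.ne'
  have ht0 : 0 < t ^ 2 := by rw [ht]; positivity
  have h := hnn b ![symmPair p r q s t (t * lam), symmPair q r p s t (-(t * lam))]
    (by simp [Fin.forall_fin_two, symmPair_isSymm])
    (by simp [Fin.forall_fin_two, trace_symmPair, hpr, hqs, hqr, hps])
    (by
      simp only [Fin.forall_fin_two, Matrix.cons_val_zero, Matrix.cons_val_one,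
        sum_symmPair_mul_symmPair]
      simp [symmPair, hpq, hpr, hps, hqr, hqs, hrs,
        hpq.symm, hpr.symm, hps.symm, hqr.symm, hqs.symm, hrs.symm]
      constructor <;> linear_combination ht1)
    (by
      simp only [Fin.forall_fin_two, Matrix.cons_val_zero, Matrix.cons_val_one,
        sum_symmPair_mul_symmPair]
      simp [symmPair, hpq, hpr, hps, hqr, hqs, hrs,
        hpq.symm, hpr.symm, hps.symm, hqr.symm, hqs.symm, hrs.symm])
  simp only [Fin.sum_univ_two, Matrix.cons_val_zero, Matrix.cons_val_one,
    secondKind_symmPair hR] at h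
  obtain ⟨h1, h2, h3, h4⟩ := hR
  refine nonneg_of_mul_nonneg_right (a := 2 * t ^ 2) (h.trans_eq ?_) (by positivity)
  linear_combination 4 * t ^ 2 * lam * (h1 (b q) (b p) (b r) (b s)
    + h4 (b p) (b q) (b r) (b s) - h2 (b p) (b r) (b s) (b q) - h3 (b p) (b s) (b q) (b r))

/-- If the curvature operator of the second kind of an algebraic curvature tensor on
an inner product space of dimension `n ≥ 4` is two-non-negative, then the NIC1
condition holds. -/
theorem statement1 {V : Type*} [NormedAddCommGroup V] [InnerProductSpace ℝ V]
    [FiniteDimensional ℝ V] {n : ℕ} (hn : 4 ≤ n) (hdim : Module.finrank ℝ V = n)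
    (R : V →ₗ[ℝ] V →ₗ[ℝ] V →ₗ[ℝ] V →ₗ[ℝ] ℝ)
    (hR : IsAlgCurv R)
    (hnn : kNonNegSecondKind n 2 R) :
    ∀ e : Fin 4 → V, Orthonormal ℝ e → ∀ lam : ℝ, lam ∈ Set.Icc (0:ℝ) 1 →
      0 ≤ R (e 0) (e 2) (e 0) (e 2) + lam ^ 2 * R (e 0) (e 3) (e 0) (e 3)
          + R (e 1) (e 2) (e 1) (e 2) + lam ^ 2 * R (e 1) (e 3) (e 1) (e 3)
          - 2 * lam * R (e 0) (e 1) (e 2) (e 3) := by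
  intro e he lam _
  let ι : Fin 4 → Fin n := Fin.castLE hn
  have hι : Function.Injective ι := Fin.castLE_injective hn
  obtain ⟨b, hb⟩ : ∃ b : OrthonormalBasis (Fin n) ℝ V, ∀ i, b (ι i) = e i := by
    obtain ⟨b, hb⟩ := Orthonormal.exists_orthonormalBasis_extension_of_card_eq
      (ι := Fin n) (𝕜 := ℝ) (by simpa using hdim) (v := Function.extend ι e 0)
      (s := Set.range ι) (by
        have : e ∘ (Equiv.ofInjective ι hι).symm
            = (Set.range ι).domRestrict (Function.extend ι e 0) := by
          funext ⟨_, i, rfl⟩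
          simp [hι.extend_apply]
        exact this ▸ he.comp _ (Equiv.injective _))
    exact ⟨b, fun i => by rw [hb _ ⟨i, rfl⟩, hι.extend_apply]⟩
  have key (μ : ℝ) := hnn.four_frame hR b (p := ι 0) (q := ι 1) (r := ι 2) (s := ι 3)
    (hι.ne (by decide)) (hι.ne (by decide)) (hι.ne (by decide))
    (hι.ne (by decide)) (hι.ne (by decide)) (hι.ne (by decide)) μ
  simp only [hb] at key
  have hneg := key (-lam)
  rw [neg_sq] at hneg
  linarith [key lam]
end
end

section
/- Let V be a real inner product space of dimension n ≥ 4 and let R be an algebraic curvature tensor on V whose curvature operator of the second kind R̂ is two-positive. Then for every orthonormal 4-tuple (e₁,e₂,e₃,e₄) in V and every λ ∈ [0,1], (R_{1313} + R_{2323}) + λ²(R_{1414} + R_{2424}) − 6λ|R_{1234}| > 0. -/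
open scoped BigOperators

noncomputable section

/-- `R̂` is `k`-positive: for every orthonormal basis and every `k` pairwise
orthogonal unit-norm trace-free symmetric two-tensors `h_1, …, h_k` (given by
their component matrices), `∑ₐ R̂(hₐ,hₐ) > 0`. -/
def kPositiveSecondKind {V : Type*} [NormedAddCommGroup V] [InnerProductSpace ℝ V]
    (n k : ℕ) (R : V →ₗ[ℝ] V →ₗ[ℝ] V →ₗ[ℝ] V →ₗ[ℝ] ℝ) : Prop :=
  ∀ (b : OrthonormalBasis (Fin n) ℝ V) (h : Fin k → Matrix (Fin n) (Fin n) ℝ),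
    (∀ a, (h a).IsSymm) →
    (∀ a, (h a).trace = 0) →
    (∀ a, ∑ i, ∑ j, h a i j * h a i j = 1) →
    (∀ a a', a ≠ a' → ∑ i, ∑ j, h a i j * h a' i j = 0) →
    0 < ∑ a, secondKind R b (h a) (h a)

section SecondKind

variable {V : Type*} [NormedAddCommGroup V] [InnerProductSpace ℝ V] {n : ℕ}
  (R : V →ₗ[ℝ] V →ₗ[ℝ] V →ₗ[ℝ] V →ₗ[ℝ] ℝ) (b : OrthonormalBasis (Fin n) ℝ V)

theorem secondKind_add_left (s s' t : Matrix (Fin n) (Fin n) ℝ) :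
    secondKind R b (s + s') t = secondKind R b s t + secondKind R b s' t := by
  simp [secondKind, mul_add, add_mul, Finset.sum_add_distrib]

theorem secondKind_add_right (s t t' : Matrix (Fin n) (Fin n) ℝ) :
    secondKind R b s (t + t') = secondKind R b s t + secondKind R b s t' := by
  simp [secondKind, mul_add, Finset.sum_add_distrib]

theorem secondKind_smul_left (c : ℝ) (s t : Matrix (Fin n) (Fin n) ℝ) :
    secondKind R b (c • s) t = c * secondKind R b s t := by
  simp only [secondKind, Finset.mul_sum, Matrix.smul_apply, smul_eq_mul]
  congr! 4
  ring

theorem secondKind_smul_right (c : ℝ) (s t : Matrix (Fin n) (Fin n) ℝ) :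
    secondKind R b s (c • t) = c * secondKind R b s t := by
  simp only [secondKind, Finset.mul_sum, Matrix.smul_apply, smul_eq_mul]
  congr! 4
  ring

theorem secondKind_single (p q r s : Fin n) :
    secondKind R b (Matrix.single p q 1) (Matrix.single r s 1) =
      R (b r) (b p) (b q) (b s) := by
  simp [secondKind, Matrix.single_apply, ite_and, Finset.sum_ite_irrel]

end SecondKind

/-- The symmetric matrix `E_{pq} + E_{qp}`. -/
def symmSingle {n : ℕ} (p q : Fin n) : Matrix (Fin n) (Fin n) ℝ :=
  Matrix.single p q 1 + Matrix.single q p 1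

theorem symmSingle_isSymm {n : ℕ} (p q : Fin n) : (symmSingle p q).IsSymm := by
  simp [symmSingle, Matrix.IsSymm, add_comm]

theorem trace_symmSingle {n : ℕ} {p q : Fin n} (h : p ≠ q) : (symmSingle p q).trace = 0 := by
  simp [symmSingle, Matrix.trace_single_eq_of_ne, h, h.symm]

theorem secondKind_symmSingle {V : Type*} [NormedAddCommGroup V] [InnerProductSpace ℝ V] {n : ℕ}
    (R : V →ₗ[ℝ] V →ₗ[ℝ] V →ₗ[ℝ] V →ₗ[ℝ] ℝ) (b : OrthonormalBasis (Fin n) ℝ V)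
    (p q r s : Fin n) :
    secondKind R b (symmSingle p q) (symmSingle r s) =
      R (b r) (b p) (b q) (b s) + R (b s) (b p) (b q) (b r)
        + (R (b r) (b q) (b p) (b s) + R (b s) (b q) (b p) (b r)) := by
  simp only [symmSingle, secondKind_add_left, secondKind_add_right, secondKind_single]
  ring

theorem sum_mul_eq_trace {n : ℕ} (s t : Matrix (Fin n) (Fin n) ℝ) :
    ∑ i, ∑ j, s i j * t i j = (s * t.transpose).trace := by
  simp [Matrix.trace, Matrix.mul_apply]

theorem trace_symmSingle_mul_symmSingle {n : ℕ} (p q r s : Fin n) :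
    (symmSingle p q * symmSingle r s).trace =
      2 * ((if p = r ∧ q = s then 1 else 0) + (if p = s ∧ q = r then 1 else 0)) := by
  simp only [symmSingle, add_mul, mul_add, Matrix.trace_add, Matrix.trace_single_mul,
    Matrix.single_apply]
  simp only [and_comm, eq_comm, smul_eq_mul, one_mul]
  ring

/-- The basic estimate: two-positivity tested on `e₁ ⊙ e₃ + μ e₂ ⊙ e₄` and
`e₂ ⊙ e₃ - μ e₁ ⊙ e₄`. -/
theorem twoPositive_curvature_bound {V : Type*} [NormedAddCommGroup V] [InnerProductSpace ℝ V]
    {n : ℕ} {R : V →ₗ[ℝ] V →ₗ[ℝ] V →ₗ[ℝ] V →ₗ[ℝ] ℝ} (hR : IsAlgCurv R)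
    (hpos : kPositiveSecondKind n 2 R) (b : OrthonormalBasis (Fin n) ℝ V)
    {p q r s : Fin n} (hpq : p ≠ q) (hpr : p ≠ r) (hps : p ≠ s) (hqr : q ≠ r) (hqs : q ≠ s)
    (hrs : r ≠ s) (μ : ℝ) :
    0 < (R (b p) (b r) (b p) (b r) + R (b q) (b r) (b q) (b r))
      + μ ^ 2 * (R (b p) (b s) (b p) (b s) + R (b q) (b s) (b q) (b s))
      - 6 * μ * R (b p) (b q) (b r) (b s) := by
  obtain ⟨h1, h2, h3, h4⟩ := hR
  set c : ℝ := (Real.sqrt (2 + 2 * μ ^ 2))⁻¹ with hc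
  have hc2 : c * c * (2 + 2 * μ ^ 2) = 1 := by
    have h : 0 < 2 + 2 * μ ^ 2 := by positivity
    rw [hc, ← mul_inv, Real.mul_self_sqrt h.le, inv_mul_cancel₀ h.ne']
  have key := hpos b
    ![c • (symmSingle p r + μ • symmSingle q s), c • (symmSingle q r + (-μ) • symmSingle p s)]
    (by
      intro a
      fin_cases a
      · exact ((symmSingle_isSymm p r).add ((symmSingle_isSymm q s).smul μ)).smul c
      · exact ((symmSingle_isSymm q r).add ((symmSingle_isSymm p s).smul (-μ))).smul c)
    (by
      intro a
      fin_cases a <;> simp [trace_symmSingle, *])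
    (by
      intro a
      simp only [sum_mul_eq_trace]
      fin_cases a <;>
      · simp [(symmSingle_isSymm _ _).eq, add_mul, mul_add, trace_symmSingle_mul_symmSingle,
          hpq, hpr, hps, hqr, hqs, hrs, hpq.symm, hpr.symm, hps.symm, hqr.symm, hqs.symm, hrs.symm]
        linear_combination hc2)
    (by
      intro a a' ha
      simp only [sum_mul_eq_trace]
      fin_cases a <;> fin_cases a' <;> first | exact absurd rfl ha | skip
      all_goals
        simp [(symmSingle_isSymm _ _).eq, add_mul, mul_add, trace_symmSingle_mul_symmSingle,
          hpq, hpr, hps, hqr, hqs, hrs, hpq.symm, hpr.symm, hps.symm, hqr.symm, hqs.symm, hrs.symm])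
  have hcross : ∀ x y u v, secondKind R b (symmSingle x y) (symmSingle u v) =
      2 * (R (b u) (b x) (b y) (b v) + R (b v) (b x) (b y) (b u)) := fun x y u v => by
    rw [secondKind_symmSingle]
    linarith [h3 (b u) (b y) (b x) (b v), h3 (b v) (b y) (b x) (b u),
      h1 (b x) (b v) (b u) (b y), h2 (b v) (b x) (b u) (b y),
      h1 (b x) (b u) (b v) (b y), h2 (b u) (b x) (b v) (b y)]
  have hself : ∀ x y, secondKind R b (symmSingle x y) (symmSingle x y) =
      2 * R (b x) (b y) (b x) (b y) := fun x y => by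
    rw [hcross]
    linarith [h1 (b x) (b x) (b y) (b y), h1 (b y) (b x) (b y) (b x), h2 (b x) (b y) (b y) (b x)]
  have hmixed : secondKind R b (symmSingle p r) (symmSingle q s)
      + secondKind R b (symmSingle q s) (symmSingle p r)
      - secondKind R b (symmSingle q r) (symmSingle p s)
      - secondKind R b (symmSingle p s) (symmSingle q r) =
      -12 * R (b p) (b q) (b r) (b s) := by
    simp only [hcross]
    have a₁ := h1 (b p) (b q) (b r) (b s)
    have a₂ := h2 (b p) (b q) (b r) (b s)
    have a₃ := h2 (b q) (b p) (b r) (b s)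
    have b₁ := h1 (b p) (b r) (b q) (b s)
    have b₂ := h2 (b p) (b r) (b q) (b s)
    have c₁ := h1 (b p) (b s) (b q) (b r)
    linarith [h4 (b p) (b q) (b r) (b s), h3 (b r) (b q) (b s) (b p),
      h3 (b s) (b q) (b r) (b p), h3 (b q) (b s) (b r) (b p), h3 (b q) (b r) (b s) (b p),
      h2 (b s) (b p) (b r) (b q), h2 (b r) (b p) (b s) (b q)]
  simp only [Fin.sum_univ_two, Matrix.cons_val_zero, Matrix.cons_val_one, secondKind_smul_left,
    secondKind_smul_right, secondKind_add_left, secondKind_add_right, hself] at key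
  refine pos_of_mul_pos_right (a := 2 * (c * c)) ?_ (by positivity)
  refine key.trans_eq ?_
  linear_combination (c * c * μ) * hmixed

/-- If the curvature operator of the second kind of an algebraic curvature tensor on
an inner product space of dimension `n ≥ 4` is two-positive, then for every
orthonormal 4-tuple and every `λ ∈ [0,1]`,
`(R₁₃₁₃ + R₂₃₂₃) + λ²(R₁₄₁₄ + R₂₄₂₄) − 6λ|R₁₂₃₄| > 0`. -/
theorem statement4 {V : Type*} [NormedAddCommGroup V] [InnerProductSpace ℝ V]
    [FiniteDimensional ℝ V] {n : ℕ} (hn : 4 ≤ n) (hdim : Module.finrank ℝ V = n)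
    (R : V →ₗ[ℝ] V →ₗ[ℝ] V →ₗ[ℝ] V →ₗ[ℝ] ℝ)
    (hR : IsAlgCurv R)
    (hpos : kPositiveSecondKind n 2 R) :
    ∀ e : Fin 4 → V, Orthonormal ℝ e → ∀ lam : ℝ, lam ∈ Set.Icc (0:ℝ) 1 →
      0 < (R (e 0) (e 2) (e 0) (e 2) + R (e 1) (e 2) (e 1) (e 2))
          + lam ^ 2 * (R (e 0) (e 3) (e 0) (e 3) + R (e 1) (e 3) (e 1) (e 3))
          - 6 * lam * |R (e 0) (e 1) (e 2) (e 3)| := by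
  intro e he lam _
  let ι : Fin 4 → Fin n := Fin.castLE hn
  have hι : Function.Injective ι := Fin.castLE_injective hn
  obtain ⟨b, hb⟩ : ∃ b : OrthonormalBasis (Fin n) ℝ V, ∀ i, b (ι i) = e i := by
    have hext : ∀ i, Function.extend ι e 0 (ι i) = e i := hι.extend_apply e 0
    have hv : Orthonormal ℝ ((Set.range ι).domRestrict (Function.extend ι e 0)) := by
      have := he.comp (Equiv.ofInjective ι hι).symm (Equiv.injective _)
      convert this using 1
      ext ⟨_, i, rfl⟩
      simp [hext]
    obtain ⟨b, hb⟩ := hv.exists_orthonormalBasis_extension_of_card_eq (by simpa using hdim)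
    exact ⟨b, fun i => (hb _ ⟨i, rfl⟩).trans (hext i)⟩
  have bound := twoPositive_curvature_bound hR hpos b (p := ι 0) (q := ι 1) (r := ι 2) (s := ι 3)
    (hι.ne (by decide)) (hι.ne (by decide)) (hι.ne (by decide)) (hι.ne (by decide))
    (hι.ne (by decide)) (hι.ne (by decide))
  simp only [hb] at bound
  rcases abs_choice (R (e 0) (e 1) (e 2) (e 3)) with h | h <;> rw [h]
  · exact bound lam
  · linarith [bound (-lam), neg_sq lam]
end
end

section
/- Let V be a real inner product space of dimension n ≥ 4 and let R be an algebraic curvature tensor on V whose curvature operator of the second kind R̂ is four-positive. Then for every orthonormal 4-tuple (e₁,e₂,e₃,e₄) in V, 3(R_{1313} + R_{2424}) + (R_{1414} + R_{2323}) − 6R_{1234} > 0. -/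
open scoped BigOperators

noncomputable section

/-- The extension by zero of a `4 × 4` matrix to a `(4 + m) × (4 + m)` matrix. -/
def extendByZero (m : ℕ) (A : Matrix (Fin 4) (Fin 4) ℝ) : Matrix (Fin (4 + m)) (Fin (4 + m)) ℝ :=
  Matrix.reindex finSumFinEquiv finSumFinEquiv (Matrix.fromBlocks A 0 0 0)

section extendByZero

variable {m : ℕ} (A B : Matrix (Fin 4) (Fin 4) ℝ)

@[simp]
theorem extendByZero_castAdd_castAdd (p q : Fin 4) :
    extendByZero m A (Fin.castAdd m p) (Fin.castAdd m q) = A p q := by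
  simp [extendByZero]

@[simp]
theorem extendByZero_natAdd_left (p : Fin m) (j : Fin (4 + m)) :
    extendByZero m A (Fin.natAdd 4 p) j = 0 := by
  induction j using Fin.addCases <;> simp [extendByZero]

@[simp]
theorem extendByZero_natAdd_right (i : Fin (4 + m)) (q : Fin m) :
    extendByZero m A i (Fin.natAdd 4 q) = 0 := by
  induction i using Fin.addCases <;> simp [extendByZero]

theorem extendByZero_isSymm (hA : A.IsSymm) : (extendByZero m A).IsSymm := by
  ext i j
  induction i using Fin.addCases <;> induction j using Fin.addCases <;> simp [hA.apply]

theorem extendByZero_trace : (extendByZero m A).trace = A.trace := by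
  simp [Matrix.trace, Fin.sum_univ_add (a := 4) (b := m)]

theorem sum_extendByZero_mul :
    ∑ i, ∑ j, extendByZero m A i j * extendByZero m B i j = ∑ p, ∑ q, A p q * B p q := by
  simp [Fin.sum_univ_add (a := 4) (b := m)]

theorem secondKind_extendByZero {V : Type*} [NormedAddCommGroup V] [InnerProductSpace ℝ V]
    (R : V →ₗ[ℝ] V →ₗ[ℝ] V →ₗ[ℝ] V →ₗ[ℝ] ℝ) (b : OrthonormalBasis (Fin (4 + m)) ℝ V)
    {e : Fin 4 → V} (hb : ∀ p, b (Fin.castAdd m p) = e p) :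
    secondKind R b (extendByZero m A) (extendByZero m B) =
      ∑ p, ∑ q, ∑ r, ∑ s, R (e p) (e r) (e s) (e q) * A r s * B p q := by
  simp [secondKind, Fin.sum_univ_add (a := 4) (b := m), hb]

end extendByZero

/-- An orthonormal family of four vectors extends to an orthonormal basis. -/
theorem exists_orthonormalBasis_castAdd {V : Type*} [NormedAddCommGroup V] [InnerProductSpace ℝ V]
    [FiniteDimensional ℝ V] {m : ℕ} (hdim : Module.finrank ℝ V = 4 + m) {e : Fin 4 → V}
    (he : Orthonormal ℝ e) :
    ∃ b : OrthonormalBasis (Fin (4 + m)) ℝ V, ∀ p, b (Fin.castAdd m p) = e p := by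
  have hv : Orthonormal ℝ ((Set.range (Fin.castAdd m)).domRestrict
      (Fin.append e (fun _ : Fin m => (0 : V)))) := by
    have hs := he.comp _ (Equiv.ofInjective _ (Fin.castAdd_injective 4 m)).symm.injective
    convert hs using 1
    ext ⟨_, p, rfl⟩
    simp [Equiv.ofInjective_symm_apply, Set.domRestrict]
  obtain ⟨b, hb⟩ := hv.exists_orthonormalBasis_extension_of_card_eq (by simpa using hdim)
  exact ⟨b, fun p => by simpa using hb _ ⟨p, rfl⟩⟩

/-- Four pairwise orthogonal trace-free symmetric tensors; they have norm one when `c * c = 1 / 2`. -/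
def testTensors (c : ℝ) : Fin 4 → Matrix (Fin 4) (Fin 4) ℝ :=
  ![!![c, 0, 0, 0; 0, 0, 0, 0; 0, 0, -c, 0; 0, 0, 0, 0],
    !![0, 0, 0, 0; 0, c, 0, 0; 0, 0, 0, 0; 0, 0, 0, -c],
    !![0, 0, 1 / 2, 0; 0, 0, 0, 1 / 2; 1 / 2, 0, 0, 0; 0, 1 / 2, 0, 0],
    !![0, 0, 0, 1 / 2; 0, 0, -1 / 2, 0; 0, -1 / 2, 0, 0; 1 / 2, 0, 0, 0]]

theorem testTensors_isSymm (c : ℝ) (a : Fin 4) : (testTensors c a).IsSymm := by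
  ext i j
  fin_cases a <;> fin_cases i <;> fin_cases j <;> simp [testTensors]

theorem testTensors_trace (c : ℝ) (a : Fin 4) : (testTensors c a).trace = 0 := by
  fin_cases a <;> simp [testTensors, Matrix.trace, Fin.sum_univ_four]

theorem testTensors_norm {c : ℝ} (hc : c * c = 1 / 2) (a : Fin 4) :
    ∑ p, ∑ q, testTensors c a p q * testTensors c a p q = 1 := by
  fin_cases a <;> simp [testTensors, Fin.sum_univ_four, hc] <;> norm_num

theorem testTensors_orthogonal (c : ℝ) {a a' : Fin 4} (h : a ≠ a') :
    ∑ p, ∑ q, testTensors c a p q * testTensors c a' p q = 0 := by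
  fin_cases a <;> fin_cases a' <;> first | exact absurd rfl h | simp [testTensors, Fin.sum_univ_four]

theorem IsAlgCurv.sum_testTensors {V : Type*} [NormedAddCommGroup V] [InnerProductSpace ℝ V]
    {R : V →ₗ[ℝ] V →ₗ[ℝ] V →ₗ[ℝ] V →ₗ[ℝ] ℝ} (hR : IsAlgCurv R) {c : ℝ} (hc : c * c = 1 / 2)
    (e : Fin 4 → V) :
    2 * ∑ a, ∑ p, ∑ q, ∑ r, ∑ s,
        R (e p) (e r) (e s) (e q) * testTensors c a r s * testTensors c a p q =
      3 * (R (e 0) (e 2) (e 0) (e 2) + R (e 1) (e 3) (e 1) (e 3))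
        + (R (e 0) (e 3) (e 0) (e 3) + R (e 1) (e 2) (e 1) (e 2))
        - 6 * R (e 0) (e 1) (e 2) (e 3) := by
  obtain ⟨h1, h2, h3, h4⟩ := hR
  have hz : ∀ x z w, R x x z w = 0 := fun x z w => by linarith [h1 x x z w]
  have hz' : ∀ x y z, R x y z z = 0 := fun x y z => by linarith [h2 x y z z]
  simp [testTensors, Fin.sum_univ_four, hz, hz', mul_assoc, hc]
  linarith only [h2 (e 0) (e 1) (e 2) (e 3), h1 (e 0) (e 1) (e 2) (e 3), h1 (e 0) (e 1) (e 3) (e 2),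
    h3 (e 0) (e 1) (e 2) (e 3), h3 (e 1) (e 0) (e 3) (e 2), h3 (e 1) (e 0) (e 2) (e 3),
    h3 (e 0) (e 1) (e 3) (e 2), h3 (e 0) (e 2) (e 1) (e 3), h1 (e 0) (e 2) (e 3) (e 1),
    h2 (e 0) (e 2) (e 1) (e 3), h3 (e 2) (e 0) (e 3) (e 1), h3 (e 0) (e 3) (e 1) (e 2),
    h3 (e 2) (e 1) (e 3) (e 0), h1 (e 0) (e 3) (e 2) (e 1), h2 (e 0) (e 3) (e 1) (e 2),
    h4 (e 0) (e 1) (e 2) (e 3), h2 (e 0) (e 2) (e 0) (e 2), h1 (e 0) (e 2) (e 0) (e 2),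
    h1 (e 0) (e 2) (e 2) (e 0), h2 (e 1) (e 3) (e 1) (e 3), h1 (e 1) (e 3) (e 1) (e 3),
    h1 (e 1) (e 3) (e 3) (e 1), h2 (e 0) (e 3) (e 0) (e 3), h1 (e 0) (e 3) (e 0) (e 3),
    h1 (e 0) (e 3) (e 3) (e 0), h2 (e 1) (e 2) (e 1) (e 2), h1 (e 1) (e 2) (e 1) (e 2),
    h1 (e 1) (e 2) (e 2) (e 1)]

/-- If the curvature operator of the second kind of an algebraic curvature tensor on
an inner product space of dimension `n ≥ 4` is four-positive, then for every
orthonormal 4-tuple, `3(R₁₃₁₃ + R₂₄₂₄) + (R₁₄₁₄ + R₂₃₂₃) − 6R₁₂₃₄ > 0`. -/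
theorem statement6 {V : Type*} [NormedAddCommGroup V] [InnerProductSpace ℝ V]
    [FiniteDimensional ℝ V] {n : ℕ} (hn : 4 ≤ n) (hdim : Module.finrank ℝ V = n)
    (R : V →ₗ[ℝ] V →ₗ[ℝ] V →ₗ[ℝ] V →ₗ[ℝ] ℝ)
    (hR : IsAlgCurv R)
    (hpos : kPositiveSecondKind n 4 R) :
    ∀ e : Fin 4 → V, Orthonormal ℝ e →
      0 < 3 * (R (e 0) (e 2) (e 0) (e 2) + R (e 1) (e 3) (e 1) (e 3))
          + (R (e 0) (e 3) (e 0) (e 3) + R (e 1) (e 2) (e 1) (e 2))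
          - 6 * R (e 0) (e 1) (e 2) (e 3) := by
  intro e he
  obtain ⟨m, rfl⟩ := Nat.exists_eq_add_of_le hn
  obtain ⟨b, hb⟩ := exists_orthonormalBasis_castAdd hdim he
  obtain ⟨c, hc⟩ : ∃ c : ℝ, c * c = 1 / 2 := ⟨√(1 / 2), Real.mul_self_sqrt (by norm_num)⟩
  have key := hpos b (fun a => extendByZero m (testTensors c a))
    (fun a => extendByZero_isSymm _ (testTensors_isSymm c a))
    (fun a => (extendByZero_trace _).trans (testTensors_trace c a))
    (fun a => (sum_extendByZero_mul _ _).trans (testTensors_norm hc a))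
    (fun a a' h => (sum_extendByZero_mul _ _).trans (testTensors_orthogonal c h))
  simp only [secondKind_extendByZero _ _ R b hb] at key
  rw [← hR.sum_testTensors hc e]
  exact mul_pos two_pos key
end
end
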